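/- arXiv:2102.13004 — 5 statements merged into one kernel-verified Lean document; each statement's English description precedes it below -/
import Mathlib

section
/- (Price of sparsity.) Fix m ≥ 1, v ∈ {0,1}^m, and D ∈ ℝ^m with D_i ≥ 0 for all i and S := Σ_{i=1}^{m} D_i > 0. Let p be the probability mass function on {1, …, m} with p(i) = D_i / S, let μ := Σ_{i=1}^{m} p(i) v_i (so that ⟨D, v⟩ = S μ), and let s_D := Σ_{i=1}^{m} p(i) |v_i - μ| be the mean absolute deviation of v under p. Let r_1, …, r_k be i.i.d. random indices distributed according to p (k ≥ 1), let M := (1/k) Σ_{j=1}^{k} v_{r_j}, and set Ŷ := σ(⟨D, v⟩) and Ỹ := σ(S · M). Then E| log Ŷ - log Ỹ | < s_D · S + max(2S, 1). -/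
open Real

/-- On `[0, S]` the logarithm of the rescaled logistic function oscillates by less than `2 * S`. -/
lemma abs_log_logistic_sub_lt {S a b : ℝ} (hS : 0 < S) (ha : a ∈ Set.Icc 0 S)
    (hb : b ∈ Set.Icc 0 S) :
    |log (exp a / (exp a + exp (1 - a))) - log (exp b / (exp b + exp (1 - b)))| < 2 * S := by
  have key : ∀ {x y : ℝ}, x ∈ Set.Icc 0 S → y ∈ Set.Icc 0 S →
      log (exp x / (exp x + exp (1 - x))) - log (exp y / (exp y + exp (1 - y))) < 2 * S := by
    intro x y hx hy
    rw [← log_div (by positivity) (by positivity), log_lt_iff_lt_exp (by positivity),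
      div_lt_iff₀ (by positivity), ← mul_div_assoc, div_lt_div_iff₀ (by positivity) (by positivity)]
    simp only [mul_add, ← exp_add]
    refine add_lt_add_of_lt_of_le (exp_lt_exp.2 (by linarith)) (exp_le_exp.2 ?_)
    linarith [hx.1, hx.2, hy.1, hy.2]
  rw [abs_lt]
  constructor <;> linarith [key ha hb, key hb ha]

/-- A weighted average of values below `c` is below `c`. -/
lemma sum_mul_lt_of_forall_lt {ι : Type*} [Fintype ι] {w f : ι → ℝ} {c : ℝ}
    (hw : ∀ i, 0 ≤ w i) (hw1 : ∑ i, w i = 1) (hf : ∀ i, f i < c) : ∑ i, w i * f i < c := by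
  obtain ⟨i, -, hi⟩ : ∃ i ∈ Finset.univ, 0 < w i :=
    Finset.exists_lt_of_sum_lt (f := fun _ => (0 : ℝ)) (by simp [hw1])
  calc ∑ i, w i * f i < ∑ i, w i * c :=
        Finset.sum_lt_sum (fun j _ => mul_le_mul_of_nonneg_left (hf j).le (hw j))
          ⟨i, Finset.mem_univ i, mul_lt_mul_of_pos_left (hf i) hi⟩
    _ = c := by rw [← Finset.sum_mul, hw1, one_mul]

theorem price_of_sparsity
    (σ : ℝ → ℝ) (hσ : ∀ x : ℝ, σ x = exp x / (exp x + exp (1 - x)))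
    (m : ℕ) (hm : 1 ≤ m)
    (v D : Fin m → ℝ) (hv : ∀ i, v i = 0 ∨ v i = 1) (hD : ∀ i, 0 ≤ D i)
    (S : ℝ) (hS : S = ∑ i, D i) (hSpos : 0 < S)
    (p : Fin m → ℝ) (hp : ∀ i, p i = D i / S)
    (μ : ℝ) (hμ : μ = ∑ i, p i * v i)
    (sD : ℝ) (hsD : sD = ∑ i, p i * |v i - μ|)
    (k : ℕ) (hk : 1 ≤ k) :
    ∑ r : Fin k → Fin m, (∏ j, p (r j)) *
        |log (σ (∑ i, D i * v i)) - log (σ (S * ((1 / (k : ℝ)) * ∑ j, v (r j))))|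
      < sD * S + max (2 * S) 1 := by
  have hv0 : ∀ i, 0 ≤ v i := fun i => by rcases hv i with h | h <;> simp [h]
  have hv1 : ∀ i, v i ≤ 1 := fun i => by rcases hv i with h | h <;> simp [h]
  have hp0 : ∀ i, 0 ≤ p i := fun i => by rw [hp]; exact div_nonneg (hD i) hSpos.le
  have hp1 : ∑ i, p i = 1 := by
    simp only [hp, ← Finset.sum_div, ← hS, div_self hSpos.ne']
  have hsD0 : 0 ≤ sD := hsD ▸ Finset.sum_nonneg fun i _ => mul_nonneg (hp0 i) (abs_nonneg _)
  have hDv : ∑ i, D i * v i ∈ Set.Icc 0 S := by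
    refine ⟨Finset.sum_nonneg fun i _ => mul_nonneg (hD i) (hv0 i), ?_⟩
    rw [hS]
    exact Finset.sum_le_sum fun i _ => mul_le_of_le_one_right (hD i) (hv1 i)
  have hM : ∀ r : Fin k → Fin m, S * ((1 / (k : ℝ)) * ∑ j, v (r j)) ∈ Set.Icc 0 S := by
    intro r
    have hk0 : (0 : ℝ) < k := by exact_mod_cast hk
    have h0 : 0 ≤ ∑ j, v (r j) := Finset.sum_nonneg fun j _ => hv0 (r j)
    have h1 : ∑ j, v (r j) ≤ k := by
      simpa using Finset.sum_le_card_nsmul Finset.univ (fun j => v (r j)) 1 fun j _ => hv1 (r j)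
    refine ⟨by positivity, mul_le_of_le_one_right hSpos.le ?_⟩
    rwa [one_div_mul_eq_div, div_le_one hk0]
  have hlt := sum_mul_lt_of_forall_lt (w := fun r : Fin k → Fin m => ∏ j, p (r j))
    (f := fun r => |log (σ (∑ i, D i * v i)) - log (σ (S * ((1 / (k : ℝ)) * ∑ j, v (r j))))|)
    (c := 2 * S) (fun r => Finset.prod_nonneg fun j _ => hp0 (r j))
    (by rw [← Fintype.sum_pow, hp1, one_pow])
    (fun r => by simpa only [hσ] using abs_log_logistic_sub_lt hSpos hDv (hM r))
  linarith [le_max_left (2 * S) 1, mul_nonneg hsD0 hSpos.le]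
end

section
/- (Disparity of the minimax-fair solution, concordant case.) Let α be a nonempty type, let L⁰, L¹ : α → ℝ be two group-specific risk functions, let β ∈ [0, 1), and define the overall risk L : α → ℝ by L(s) = β L⁰(s) + (1 - β) L¹(s). Suppose s⋆ ∈ α minimizes s ↦ max(L⁰(s), L¹(s)) over α, and s∘ ∈ α minimizes L over α. If moreover L¹(s⋆) ≤ L⁰(s⋆) and L¹(s∘) ≤ L⁰(s∘), then |L⁰(s⋆) - L¹(s⋆)| ≤ |L⁰(s∘) - L¹(s∘)|. -/
theorem minimax_fair_disparity_concordant
    {α : Type*} [Nonempty α]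
    (L0 L1 : α → ℝ) (β : ℝ) (hβ : β ∈ Set.Ico (0 : ℝ) 1)
    (L : α → ℝ) (hL : ∀ s, L s = β * L0 s + (1 - β) * L1 s)
    (sstar scirc : α)
    (hstar : ∀ s, max (L0 sstar) (L1 sstar) ≤ max (L0 s) (L1 s))
    (hcirc : ∀ s, L scirc ≤ L s)
    (h1 : L1 sstar ≤ L0 sstar) (h2 : L1 scirc ≤ L0 scirc) :
    |L0 sstar - L1 sstar| ≤ |L0 scirc - L1 scirc| := by
  obtain ⟨hβ0, hβ1⟩ := hβ
  have h0 : L0 sstar ≤ L0 scirc := by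
    simpa only [max_eq_left h1, max_eq_left h2] using hstar scirc
  have hL1 : L1 scirc ≤ L1 sstar := by
    have h := hcirc sstar
    rw [hL, hL] at h
    have h' := mul_le_mul_of_nonneg_left h0 hβ0
    exact le_of_mul_le_mul_left (by linarith) (sub_pos.mpr hβ1)
  rw [abs_of_nonneg (sub_nonneg.mpr h1), abs_of_nonneg (sub_nonneg.mpr h2)]
  exact sub_le_sub h0 hL1
end

section
/- (Disparity of the minimax-fair solution, discordant case.) Let α be a nonempty type, let L⁰, L¹ : α → ℝ be two group-specific risk functions, let β ∈ (0, 1/2], and define the overall risk L : α → ℝ by L(s) = β L⁰(s) + (1 - β) L¹(s). Suppose s⋆ ∈ α minimizes s ↦ max(L⁰(s), L¹(s)) over α, and s∘ ∈ α minimizes L over α. If moreover L¹(s⋆) ≤ L⁰(s⋆) and L⁰(s∘) ≤ L¹(s∘), then |L⁰(s⋆) - L¹(s⋆)| ≤ |L⁰(s∘) - L¹(s∘)|. -/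
theorem minimax_fair_disparity_discordant
    {α : Type*} [Nonempty α]
    (L0 L1 : α → ℝ) (β : ℝ) (hβ : β ∈ Set.Ioc (0 : ℝ) (1 / 2))
    (L : α → ℝ) (hL : ∀ s, L s = β * L0 s + (1 - β) * L1 s)
    (sstar scirc : α)
    (hstar : ∀ s, max (L0 sstar) (L1 sstar) ≤ max (L0 s) (L1 s))
    (hcirc : ∀ s, L scirc ≤ L s)
    (h1 : L1 sstar ≤ L0 sstar) (h2 : L0 scirc ≤ L1 scirc) :
    |L0 sstar - L1 sstar| ≤ |L0 scirc - L1 scirc| := by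
  obtain ⟨hβ0, hβ1⟩ := hβ
  have hmax := hstar scirc
  rw [max_eq_left h1, max_eq_right h2] at hmax
  have hrisk := hcirc sstar
  rw [hL, hL] at hrisk
  rw [abs_of_nonneg (sub_nonneg.2 h1), abs_of_nonpos (sub_nonpos.2 h2)]
  by_contra! hlt
  have hgap := mul_pos hβ0 (sub_pos.2 hlt)
  have hweight : 0 ≤ (1 - 2 * β) * (L0 sstar - L1 sstar) :=
    mul_nonneg (by linarith) (sub_nonneg.2 h1)
  linarith
end

section
/- (Disparity of the minimax-fair solution, balanced groups.) Let α be a nonempty type, let L⁰, L¹ : α → ℝ be two group-specific risk functions, and define the overall risk L : α → ℝ by L(s) = (L⁰(s) + L¹(s)) / 2. Suppose s⋆ ∈ α minimizes s ↦ max(L⁰(s), L¹(s)) over α, and s∘ ∈ α minimizes L over α. Then |L⁰(s⋆) - L¹(s⋆)| ≤ |L⁰(s∘) - L¹(s∘)|, i.e., the minimax-fair solution has risk disparity between the two groups no larger than that of the overall-risk minimizer. -/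
theorem minimax_fair_disparity_balanced
    {α : Type*} [Nonempty α]
    (L0 L1 : α → ℝ)
    (L : α → ℝ) (hL : ∀ s, L s = (L0 s + L1 s) / 2)
    (sstar scirc : α)
    (hstar : ∀ s, max (L0 sstar) (L1 sstar) ≤ max (L0 s) (L1 s))
    (hcirc : ∀ s, L scirc ≤ L s) :
    |L0 sstar - L1 sstar| ≤ |L0 scirc - L1 scirc| := by
  have max_eq (s : α) : max (L0 s) (L1 s) = L s + |L0 s - L1 s| / 2 := by
    linarith [hL s, max_add_min (L0 s) (L1 s), max_sub_min_eq_abs' (L0 s) (L1 s)]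
  have hmax := hstar scirc
  rw [max_eq, max_eq] at hmax
  linarith [hcirc sstar]
end

section
/- (Group-risk comparison at the minimax-fair solution.) Let α be a nonempty type, let L⁰, L¹ : α → ℝ, let β ∈ [0, 1), and define L(s) = β L⁰(s) + (1 - β) L¹(s). Suppose s⋆ ∈ α minimizes s ↦ max(L⁰(s), L¹(s)) over α, s∘ ∈ α minimizes L over α, and L¹(s∘) ≤ L⁰(s∘). Then L⁰(s⋆) ≤ L⁰(s∘) and L¹(s⋆) ≥ L¹(s∘); that is, compared with the overall-risk minimizer, the minimax-fair solution weakly decreases the risk of the worse-off group 0 and weakly increases the risk of the better-off group 1. -/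
theorem minimax_fair_group_risk_comparison
    {α : Type*} [Nonempty α]
    (L0 L1 : α → ℝ) (β : ℝ) (hβ : β ∈ Set.Ico (0 : ℝ) 1)
    (L : α → ℝ) (hL : ∀ s, L s = β * L0 s + (1 - β) * L1 s)
    (sstar scirc : α)
    (hstar : ∀ s, max (L0 sstar) (L1 sstar) ≤ max (L0 s) (L1 s))
    (hcirc : ∀ s, L scirc ≤ L s)
    (h2 : L1 scirc ≤ L0 scirc) :
    L0 sstar ≤ L0 scirc ∧ L1 scirc ≤ L1 sstar := by
  have h0 : L0 sstar ≤ L0 scirc :=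
    (le_max_left _ _).trans ((hstar scirc).trans_eq (max_eq_left h2))
  refine ⟨h0, ?_⟩
  have hc := hcirc sstar
  rw [hL, hL] at hc
  have hmul : β * L0 sstar ≤ β * L0 scirc := mul_le_mul_of_nonneg_left h0 hβ.1
  exact le_of_mul_le_mul_left (by linarith) (sub_pos.2 hβ.2)
end
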